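/- Let k be a positive integer and let G be a k-connected finite simple graph with n > k vertices. Then F_k(G) ≤ n - γ_{k,c}(G), where γ_{k,c}(G) is the connected k-domination number of G. -/

import Mathlib

open Finset SimpleGraph

/-- One round of the `k`-forcing color change rule: to the currently colored set `C` we add
every vertex `w` having a colored neighbor `v` with at most `k` non-colored neighbors. -/
def kForceStep {V : Type*} [Fintype V] [DecidableEq V] (G : SimpleGraph V)
    [DecidableRel G.Adj] (k : ℕ) (C : Finset V) : Finset V :=
  C ∪ Finset.univ.filter (fun w =>
    ∃ v ∈ C, G.Adj v w ∧ ((G.neighborFinset v) \ C).card ≤ k)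

/-- `S` is a `k`-forcing set: iterating the color change rule starting from `S`
eventually colors all vertices. -/
def IsKForcingSet {V : Type*} [Fintype V] [DecidableEq V] (G : SimpleGraph V)
    [DecidableRel G.Adj] (k : ℕ) (S : Finset V) : Prop :=
  (kForceStep G k)^[Fintype.card V] S = Finset.univ

/-- The `k`-forcing number: the minimum cardinality of a `k`-forcing set. -/
noncomputable def kForcingNumber {V : Type*} [Fintype V] [DecidableEq V] (G : SimpleGraph V)
    [DecidableRel G.Adj] (k : ℕ) : ℕ :=
  sInf {m | ∃ S : Finset V, IsKForcingSet G k S ∧ S.card = m}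

/-- `G` is `k`-connected: it has more than `k` vertices and the removal of any set of fewer
than `k` vertices results in a connected (induced) subgraph. -/
def KConnected {V : Type*} [Fintype V] [DecidableEq V] (G : SimpleGraph V) (k : ℕ) : Prop :=
  k < Fintype.card V ∧
    ∀ A : Finset V, A.card < k → (G.induce ((A : Set V)ᶜ)).Connected

/-- `D` is a connected `k`-dominating set: every vertex not in `D` has at least `k` neighbors
in `D`, and the subgraph induced by `D` is connected. -/
def IsConnKDomSet {V : Type*} [Fintype V] [DecidableEq V] (G : SimpleGraph V)
    [DecidableRel G.Adj] (k : ℕ) (D : Finset V) : Prop :=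
  (∀ v : V, v ∉ D → k ≤ ((G.neighborFinset v) ∩ D).card) ∧
    (G.induce (D : Set V)).Connected

/-- The connected `k`-domination number: the minimum cardinality of a connected
`k`-dominating set. -/
noncomputable def connKDomNumber {V : Type*} [Fintype V] [DecidableEq V] (G : SimpleGraph V)
    [DecidableRel G.Adj] (k : ℕ) : ℕ :=
  sInf {m | ∃ D : Finset V, IsConnKDomSet G k D ∧ D.card = m}

/-- Outside a set `X` whose removal leaves the graph connected, a set of vertices closed under
adjacency is everything as soon as it is met. -/
lemma mem_of_connected_induce_compl {V : Type*} {G : SimpleGraph V} {X : Set V} {p : V → Prop}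
    (hX : (G.induce Xᶜ).Connected) {a d : V} (ha : a ∉ X) (hd : d ∉ X) (hpa : p a)
    (hp : ∀ u w, p u → G.Adj u w → w ∉ X → p w) : p d := by
  obtain ⟨q⟩ := hX.preconnected ⟨a, ha⟩ ⟨d, hd⟩
  suffices H : ∀ (x y : ↥(Xᶜ)), (G.induce Xᶜ).Walk x y → p x → p y from H _ _ q hpa
  intro x y q
  induction q with
  | nil => exact id
  | cons h _ ih => exact fun hx => ih (hp _ _ hx h (Subtype.prop (p := (· ∈ Xᶜ)) _))

/-- A set of vertices is `k`-fort-free if each of its nonempty subsets `F` has an outside vertex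
with at least one and at most `k` neighbors in `F`. -/
def IsKFortFree {V : Type*} [Fintype V] [DecidableEq V] (G : SimpleGraph V)
    [DecidableRel G.Adj] (k : ℕ) (D : Finset V) : Prop :=
  ∀ F ⊆ D, F.Nonempty → ∃ v ∉ F, (G.neighborFinset v ∩ F).Nonempty ∧
    (G.neighborFinset v ∩ F).card ≤ k

section

variable {V : Type*} [Fintype V] [DecidableEq V] {G : SimpleGraph V} [DecidableRel G.Adj] {k : ℕ}

lemma isKFortFree_empty : IsKFortFree G k ∅ := fun _ hF hne =>
  absurd (Finset.subset_empty.1 hF) hne.ne_empty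

lemma IsKFortFree.insert {D : Finset V} (hD : IsKFortFree G k D) {v b : V} (hv : v ∉ D)
    (hvk : (G.neighborFinset v ∩ D).card < k) (hvb : G.Adj v b) :
    IsKFortFree G k (insert b D) := by
  intro F hF hne
  by_cases hb : b ∈ F
  · refine ⟨v, fun h => ?_, ⟨b, by simp [hb, hvb]⟩, ?_⟩
    · rcases Finset.mem_insert.1 (hF h) with rfl | h
      · exact G.irrefl hvb
      · exact hv h
    · have hsub : G.neighborFinset v ∩ F ⊆ Insert.insert b (G.neighborFinset v ∩ D) := by
        intro x hx
        have := hF (Finset.mem_inter.1 hx).2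
        simp only [Finset.mem_insert, Finset.mem_inter] at this hx ⊢
        tauto
      have := Finset.card_le_card hsub
      have := Finset.card_insert_le b (G.neighborFinset v ∩ D)
      omega
  · exact hD F ((Finset.subset_insert_iff_of_notMem hb).1 hF) hne

lemma subset_kForceStep (C : Finset V) : C ⊆ kForceStep G k C := Finset.subset_union_left

/-- The complement of a `k`-fort-free set is `k`-forcing. -/
lemma IsKFortFree.isKForcingSet_compl {D : Finset V} (hD : IsKFortFree G k D) :
    IsKForcingSet G k Dᶜ := by
  have step : ∀ C : Finset V, Dᶜ ⊆ C → C ≠ univ → C.card < (kForceStep G k C).card := by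
    intro C hC hne
    obtain ⟨v, hv, ⟨w, hw⟩, hk⟩ := hD Cᶜ (compl_le_iff_compl_le.1 hC)
      (by rwa [Finset.nonempty_iff_ne_empty, Ne, Finset.compl_eq_empty_iff])
    simp only [Finset.mem_compl, not_not, Finset.mem_inter, mem_neighborFinset] at hv hw
    refine Finset.card_lt_card ((Finset.ssubset_iff_of_subset (subset_kForceStep C)).2
      ⟨w, Finset.mem_union_right _ ?_, hw.2⟩)
    rw [← Finset.sdiff_eq_inter_compl] at hk
    exact Finset.mem_filter.2 ⟨Finset.mem_univ _, v, hv, hw.1, hk⟩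
  have key : ∀ i, Dᶜ ⊆ (kForceStep G k)^[i] Dᶜ ∧
      ((kForceStep G k)^[i] Dᶜ = univ ∨ i ≤ ((kForceStep G k)^[i] Dᶜ).card) := by
    intro i
    induction i with
    | zero => simp
    | succ i ih =>
      rw [Function.iterate_succ_apply']
      refine ⟨ih.1.trans (subset_kForceStep _), ?_⟩
      by_cases h : (kForceStep G k)^[i] Dᶜ = univ
      · exact Or.inl (Finset.univ_subset_iff.1 (h ▸ subset_kForceStep _))
      · have := step _ ih.1 h
        have := ih.2.resolve_left h
        omega
  rcases (key (Fintype.card V)).2 with h | h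
  · exact h
  · exact (Finset.card_eq_iff_eq_univ _).1 (le_antisymm (Finset.card_le_univ _) h)

lemma KConnected.exists_adj_of_card_lt (hG : KConnected G k) {D : Finset V} (hDk : D.card < k)
    {b : V} (hb : b ∉ D) : ∃ v ∉ D, G.Adj v b := by
  by_contra! h
  have hall : ∀ d ∉ D, d = b := fun d hd =>
    mem_of_connected_induce_compl (p := fun x => x = b) (hG.2 D hDk) (by simpa using hb)
      (by simpa using hd) rfl fun u w hu huw hw =>
        absurd (hu ▸ huw.symm) (h w (by simpa using hw))
  have hsub : (univ : Finset V) ⊆ insert b D := fun x _ => by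
    by_cases hx : x ∈ D
    · exact Finset.mem_insert_of_mem hx
    · exact hall x hx ▸ Finset.mem_insert_self _ _
  have := Finset.card_le_card hsub
  have := Finset.card_insert_le b D
  have := hG.1
  rw [Finset.card_univ] at *
  omega

/-- If `D` does not `k`-dominate, then some vertex not `k`-dominated by `D` has a neighbor
outside `D` that is adjacent to `D`. -/
lemma KConnected.exists_adj_adj (hG : KConnected G k) {D : Finset V} (hne : D.Nonempty)
    {v : V} (hv : v ∉ D) (hvk : (G.neighborFinset v ∩ D).card < k) :
    ∃ u ∉ D, (G.neighborFinset u ∩ D).card < k ∧ ∃ b ∉ D, G.Adj u b ∧ ∃ d ∈ D, G.Adj d b := by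
  rcases lt_or_ge D.card k with hDk | hDk
  · obtain ⟨d, hd⟩ := hne
    obtain ⟨b, hb, hb'⟩ : ∃ b ∉ D, ∃ d ∈ D, G.Adj d b := by
      by_contra! h
      refine hv (mem_of_connected_induce_compl (p := (· ∈ D)) (hG.2 ∅ (by simp; omega))
        (by simp) (by simp) hd fun u w hu huw _ => ?_)
      by_contra hw
      exact h w hw u hu huw
    obtain ⟨u, hu, hub⟩ := hG.exists_adj_of_card_lt hDk hb
    exact ⟨u, hu, (Finset.card_le_card Finset.inter_subset_right).trans_lt hDk,
      b, hb, hub, hb'⟩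
  · by_contra! h
    obtain ⟨d, hd, hdv⟩ : ∃ d ∈ D, d ∉ G.neighborFinset v ∩ D :=
      Finset.exists_mem_notMem_of_card_lt_card (hvk.trans_le hDk)
    have hp : d ∉ D ∧ (d = v ∨ ∀ x ∈ D, ¬ G.Adj x d) := by
      refine mem_of_connected_induce_compl
        (p := fun y => y ∉ D ∧ (y = v ∨ ∀ x ∈ D, ¬ G.Adj x y)) (hG.2 _ hvk) (a := v)
        (by simp [hv]) (by simpa using hdv) ⟨hv, Or.inl rfl⟩ ?_
      rintro u w ⟨huD, hu⟩ huw hw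
      have hwD : w ∉ D := by
        intro hwD
        rcases hu with rfl | hu
        · exact hw (by simp [hwD, huw])
        · exact hu w hwD huw.symm
      refine ⟨hwD, Or.inr (h u huD ?_ w hwD huw)⟩
      rcases hu with rfl | hu
      · exact hvk
      · rw [Finset.card_eq_zero.2]
        · omega
        · ext x
          simp only [Finset.mem_inter, mem_neighborFinset, Finset.notMem_empty, iff_false]
          exact fun hx => hu x hx.2 hx.1.symm
    exact hp.1 hd

/-- A `k`-connected graph has a connected `k`-dominating set that is `k`-fort-free. -/
lemma KConnected.exists_isConnKDomSet_isKFortFree (hG : KConnected G k) (hk : 1 ≤ k) :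
    ∃ D, IsConnKDomSet G k D ∧ IsKFortFree G k D := by
  obtain ⟨b⟩ : Nonempty V := Fintype.card_pos_iff.1 (by have := hG.1; omega)
  obtain ⟨v, hv, hvb⟩ := hG.exists_adj_of_card_lt (D := ∅) (Finset.card_empty.trans_lt hk)
    (Finset.notMem_empty b)
  have h₀ : (G.induce (({b} : Finset V) : Set V)).Connected ∧ IsKFortFree G k {b} :=
    by
    refine ⟨?_, isKFortFree_empty.insert hv (by simp; omega) hvb⟩
    rw [Finset.coe_singleton]
    exact ⟨.of_subsingleton⟩
  obtain ⟨D, -, hD⟩ := Finite.exists_le_maximal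
    (p := fun D : Finset V => (G.induce (D : Set V)).Connected ∧ IsKFortFree G k D) h₀
  refine ⟨D, ⟨fun v hv => ?_, hD.prop.1⟩, hD.prop.2⟩
  by_contra! hvk
  have hne : D.Nonempty := by
    obtain ⟨d⟩ := hD.prop.1.nonempty
    exact ⟨d, d.2⟩
  obtain ⟨u, hu, huk, b, hb, hub, d, hd, hdb⟩ := hG.exists_adj_adj hne hv hvk
  refine hb (hD.le_of_ge (y := insert b D) ⟨?_, hD.prop.2.insert hu huk hub⟩
    (Finset.subset_insert _ _) (Finset.mem_insert_self _ _))
  have hpair := induce_union_connected hD.prop.1.preconnected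
    (induce_pair_connected_of_adj hdb).preconnected ⟨d, hd, by simp⟩
  have hunion : ((insert b D : Finset V) : Set V) = (D : Set V) ∪ {d, b} := by
    ext x
    simp only [Finset.coe_insert, Set.mem_insert_iff, Set.mem_union, Set.mem_singleton_iff,
      Finset.mem_coe]
    grind
  rwa [hunion]

end

/-- Corollary: If `G` is `k`-connected with `n > k` vertices, then
`F_k(G) ≤ n - γ_{k,c}(G)`. -/
theorem kForcingNumber_le_card_sub_connKDom {V : Type*} [Fintype V] [DecidableEq V]
    (G : SimpleGraph V) [DecidableRel G.Adj] (k : ℕ) (hk : 1 ≤ k)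
    (hkconn : KConnected G k) (hn : k < Fintype.card V) :
    kForcingNumber G k ≤ Fintype.card V - connKDomNumber G k := by
  obtain ⟨D, hD, hF⟩ := hkconn.exists_isConnKDomSet_isKFortFree hk
  have h₁ : kForcingNumber G k ≤ Dᶜ.card := Nat.sInf_le ⟨Dᶜ, hF.isKForcingSet_compl, rfl⟩
  have h₂ : connKDomNumber G k ≤ D.card := Nat.sInf_le ⟨D, hD, rfl⟩
  rw [Finset.card_compl] at h₁
  omega
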